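/- arXiv:2603.11066 — 10 statements merged into one kernel-verified Lean document; each statement's English description precedes it below -/
import Mathlib

section
/- Fix an integer k ≥ 2 and an odd residue μ ∈ {1,3,5,7} with 3^k·μ ≡ 7 (mod 8). For each odd positive integer m, set P = 3^k·m, n′ = (P−1)/2, k′ = v₂(n′+1), and m′ = (n′+1)/2^{k′}. Then for every m ≡ μ (mod 8) one has k′ ≥ 2, and the ratio (#{1 ≤ m ≤ N : m ≡ μ (mod 8) and 3^{k′}·m′ ≡ 7 (mod 8)}) / (#{1 ≤ m ≤ N : m ≡ μ (mod 8)}) tends to 1/4 as N → ∞. -/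
open Filter

/-- Burst-completed successor odd integer `n′ = (3^k·m − 1)/2` of a persistent state. -/
def nSucc (k m : ℕ) : ℕ := (3 ^ k * m - 1) / 2

/-- Successor odd-run length `k′ = v₂(n′ + 1)`. -/
def kSucc (k m : ℕ) : ℕ := padicValNat 2 (nSucc k m + 1)

/-- Successor multiplier `m′ = (n′ + 1)/2^{k′}`. -/
def mSucc (k m : ℕ) : ℕ := (nSucc k m + 1) / 2 ^ kSucc k m

/-- auxiliary predicate -/
abbrev QQ (e x : ℕ) : Prop := 3 ^ (e + padicValNat 2 x) * (x / 2 ^ padicValNat 2 x) % 8 = 7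

lemma QQ_double (e y : ℕ) : QQ e (2 * y) ↔ QQ (e + 1) y := by
  rcases Nat.eq_zero_or_pos y with rfl | hy
  · simp [QQ]
  · have h : padicValNat 2 (2 * y) = 1 + padicValNat 2 y := by
      rw [padicValNat.mul (by norm_num) (by omega)]; simp
    unfold QQ
    rw [h, pow_add 2, pow_one, Nat.mul_div_mul_left _ _ (by norm_num), add_assoc]

lemma QQ_odd (e x : ℕ) (hx : x % 2 = 1) : QQ e x ↔ 3 ^ e * x % 8 = 7 := by
  have h : padicValNat 2 x = 0 := padicValNat.eq_zero_of_not_dvd (by omega)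
  simp [QQ, h]

lemma three_pow_mod (e : ℕ) : 3 ^ e % 8 = 1 ∨ 3 ^ e % 8 = 3 := by
  induction e with
  | zero => simp
  | succ n ih => rw [pow_succ]; omega

lemma residue_ex (e a c : ℕ) (hc : c % 2 = 1) :
    ∃ t1 < 8, ∀ t, 3 ^ e * (a + c * t) % 8 = 7 ↔ t % 8 = t1 := by
  have key : ∀ p a c : Fin 8, (p.val = 1 ∨ p.val = 3) → c.val % 2 = 1 →
      ∃ t1 : Fin 8, ∀ t : Fin 8, (p.val * (a.val + c.val * t.val) % 8 = 7 ↔ t.val = t1.val) := by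
    decide +kernel
  have hl : ∀ n : ℕ, n % 8 < 8 := fun n => Nat.mod_lt _ (by norm_num)
  obtain ⟨⟨t1, h1⟩, h⟩ := key ⟨3 ^ e % 8, hl _⟩ ⟨a % 8, hl _⟩ ⟨c % 8, hl _⟩
    (three_pow_mod e) (by simp only; omega)
  simp only at h
  refine ⟨t1, h1, fun t => ?_⟩
  rw [← h ⟨t % 8, hl _⟩]
  simp [Nat.mul_mod, Nat.add_mod]

lemma count_rec (e a c : ℕ) (hc : c % 2 = 1) : ∃ t1 < 8, ∃ t0 < 2, ∃ b, ∀ T,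
    Nat.count (fun t => QQ e (a + c * t)) T =
      (T + 7 - t1) / 8 + Nat.count (fun t => QQ (e + 1) (b + c * t)) ((T + 1 - t0) / 2) := by
  obtain ⟨t1, h1, h⟩ := residue_ex e a c hc
  have hpar : ∀ t, (a + c * t) % 2 = (a + t) % 2 := by
    intro t; rw [Nat.add_mod, Nat.mul_mod, hc]; simp
  refine ⟨t1, h1, a % 2, by omega, (a + c * (a % 2)) / 2, fun T => ?_⟩
  have hb : 2 * ((a + c * (a % 2)) / 2) = a + c * (a % 2) := by
    have := hpar (a % 2); omega
  generalize (a + c * (a % 2)) / 2 = b at hb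
  induction T with
  | zero =>
    have e1 : (0 + 7 - t1) / 8 = 0 := by omega
    have e2 : (0 + 1 - a % 2) / 2 = 0 := by omega
    rw [e1, e2]; simp
  | succ T ih =>
    rw [Nat.count_succ, ih]
    by_cases hT : T % 2 = a % 2
    · obtain ⟨s, hs⟩ : ∃ s, T = a % 2 + 2 * s := ⟨T / 2, by omega⟩
      have e2 : (T + 1 + 1 - a % 2) / 2 = s + 1 := by omega
      have e3 : (T + 1 - a % 2) / 2 = s := by omega
      have hx : a + c * T = 2 * (b + c * s) := by rw [hs]; linarith [mul_add c (a % 2) (2 * s)]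
      have hne : T % 8 ≠ t1 := by
        intro h'
        have := (h T).2 h'
        rw [hx] at this
        have h2 : 3 ^ e * (2 * (b + c * s)) = 2 * (3 ^ e * (b + c * s)) := by ring
        omega
      rw [e2, e3, Nat.count_succ, hx]
      simp only [QQ_double]
      omega
    · have e2 : (T + 1 + 1 - a % 2) / 2 = (T + 1 - a % 2) / 2 := by omega
      have := QQ_odd e (a + c * T) (by have := hpar T; omega)
      rw [e2]
      simp only [this, h]
      split_ifs <;> omega

lemma count_bound (c : ℕ) (hc : c % 2 = 1) (J : ℕ) : ∀ e a T : ℕ,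
    |(Nat.count (fun t => QQ e (a + c * t)) T : ℝ) - T / 4| ≤ 2 * J + T / 2 ^ J + 1 := by
  induction J with
  | zero =>
    intro e a T
    have h1 : (Nat.count (fun t => QQ e (a + c * t)) T : ℝ) ≤ T := by
      exact_mod_cast Nat.count_le _
    have h2 : (0 : ℝ) ≤ Nat.count (fun t => QQ e (a + c * t)) T := by positivity
    have h3 : (0 : ℝ) ≤ T := by positivity
    rw [abs_le]; constructor <;> norm_num <;> linarith
  | succ J ih =>
    intro e a T
    obtain ⟨t1, h1, t0, h0, b, h⟩ := count_rec e a c hc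
    rw [h T]
    have := ih (e + 1) b ((T + 1 - t0) / 2)
    generalize hu : (T + 7 - t1) / 8 = u
    generalize hv : (T + 1 - t0) / 2 = v at *
    have u1 : (8 * u : ℝ) ≤ T + 7 := by exact_mod_cast (by omega : 8 * u ≤ T + 7)
    have u2 : (T : ℝ) ≤ 8 * u + 7 := by exact_mod_cast (by omega : T ≤ 8 * u + 7)
    have v1 : (2 * v : ℝ) ≤ T + 1 := by exact_mod_cast (by omega : 2 * v ≤ T + 1)
    have v2 : (T : ℝ) ≤ 2 * v + 1 := by exact_mod_cast (by omega : T ≤ 2 * v + 1)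
    have hp : (v : ℝ) / 2 ^ J ≤ T / 2 ^ (J + 1) + 1 / 2 := by
      have hq : (1 : ℝ) ≤ 2 ^ J := one_le_pow₀ (by norm_num)
      rw [pow_succ, div_add_div _ _ (by positivity) (by norm_num),
        div_le_div_iff₀ (by positivity) (by positivity)]
      nlinarith [mul_le_mul_of_nonneg_right v1 (by positivity : (0:ℝ) ≤ 2 ^ J), mul_le_mul_of_nonneg_left hq (by positivity : (0:ℝ) ≤ 2 ^ J)]
    rw [abs_le] at this ⊢
    push_cast
    constructor <;> linarith [this.1, this.2]

lemma count_tendsto (c : ℕ) (hc : c % 2 = 1) (e a : ℕ) :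
    Tendsto (fun T : ℕ => (Nat.count (fun t => QQ e (a + c * t)) T : ℝ) / T) atTop
      (nhds (1 / 4)) := by
  rw [Metric.tendsto_atTop]
  intro ε hε
  obtain ⟨J, hJ⟩ := exists_pow_lt_of_lt_one (half_pos hε) (by norm_num : (1 / 2 : ℝ) < 1)
  obtain ⟨N, hN⟩ := exists_nat_gt ((2 * J + 1 : ℝ) / (ε / 2))
  refine ⟨N + 1, fun T hT => ?_⟩
  have hT' : (N : ℝ) + 1 ≤ T := by exact_mod_cast hT
  have hT0 : (0 : ℝ) < T := by linarith [(Nat.cast_nonneg N : (0 : ℝ) ≤ N)]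
  have hb := count_bound c hc J e a T
  rw [Real.dist_eq]
  have : (Nat.count (fun t => QQ e (a + c * t)) T : ℝ) / T - 1 / 4 =
      ((Nat.count (fun t => QQ e (a + c * t)) T : ℝ) - T / 4) / T := by field_simp
  rw [this, abs_div, abs_of_pos hT0, div_lt_iff₀ hT0]
  rw [div_lt_iff₀ (by positivity)] at hN
  have h3 : (T : ℝ) / 2 ^ J ≤ ε / 2 * T := by
    have : (T : ℝ) / 2 ^ J = (1 / 2) ^ J * T := by rw [one_div, inv_pow]; field_simp
    rw [this]; gcongr
  nlinarith

lemma card_num (p : ℕ → Prop) [DecidablePred p] (μ : ℕ) (h1 : 1 ≤ μ) (h8 : μ < 8) (N : ℕ) :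
    ((Finset.Icc 1 N).filter (fun m => m % 8 = μ ∧ p m)).card =
      Nat.count (fun t => p (μ + 8 * t)) ((N + 8 - μ) / 8) := by
  induction N with
  | zero =>
    have : (0 + 8 - μ) / 8 = 0 := by omega
    rw [this]; simp
  | succ N ih =>
    rw [← Finset.insert_Icc_right_eq_Icc_add_one (by omega), Finset.filter_insert]
    by_cases hN : (N + 1) % 8 = μ
    · obtain ⟨s, hs⟩ : ∃ s, N + 1 = μ + 8 * s := ⟨(N + 1) / 8, by omega⟩
      have e1 : (N + 1 + 8 - μ) / 8 = s + 1 := by omega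
      have e2 : (N + 8 - μ) / 8 = s := by omega
      rw [e2] at ih
      rw [e1, Nat.count_succ, ← ih, ← hs]
      by_cases hp : p (N + 1)
      · rw [if_pos ⟨hN, hp⟩, if_pos hp, Finset.card_insert_of_notMem (by simp)]
      · rw [if_neg (fun h => hp h.2), if_neg hp]; rfl
    · have e1 : (N + 1 + 8 - μ) / 8 = (N + 8 - μ) / 8 := by omega
      rw [if_neg (fun h => hN h.1), e1, ih]

/-- The 1/4 persistent-transition law: for a persistent state `(k, μ)` with `k ≥ 2`
and `3^k·μ ≡ 7 (mod 8)`, every lift `m ≡ μ (mod 8)` has successor run length `k′ ≥ 2`,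
and the fraction of lifts `1 ≤ m ≤ N` whose successor state is again persistent
(`3^{k′}·m′ ≡ 7 (mod 8)`) tends to `1/4` as `N → ∞`. -/
theorem quarter_persistent_transition_law (k : ℕ) (hk : 2 ≤ k) (μ : ℕ)
    (hμ : μ ∈ ({1, 3, 5, 7} : Finset ℕ)) (hpers : 3 ^ k * μ % 8 = 7) :
    (∀ m : ℕ, m % 8 = μ → 2 ≤ kSucc k m) ∧
    Tendsto
      (fun N : ℕ =>
        (((Finset.Icc 1 N).filter
            (fun m => m % 8 = μ ∧ 3 ^ kSucc k m * mSucc k m % 8 = 7)).card : ℝ) /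
          (((Finset.Icc 1 N).filter (fun m => m % 8 = μ)).card : ℝ))
      atTop (nhds (1 / 4)) := by
  have hμ' : 1 ≤ μ ∧ μ < 8 := by
    simp only [Finset.mem_insert, Finset.mem_singleton] at hμ; omega
  obtain ⟨a, ha⟩ : ∃ a, 3 ^ k * μ + 1 = 8 * a := ⟨(3 ^ k * μ + 1) / 8, by omega⟩
  have hn : ∀ t, nSucc k (μ + 8 * t) + 1 = 2 * (2 * (a + 3 ^ k * t)) := by
    intro t
    have : 3 ^ k * (μ + 8 * t) = 3 ^ k * μ + 8 * (3 ^ k * t) := by ring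
    unfold nSucc
    rw [this]
    omega
  constructor
  · intro m hm
    obtain ⟨t, rfl⟩ : ∃ t, m = μ + 8 * t := ⟨m / 8, by omega⟩
    unfold kSucc
    rw [hn]
    have hpos : a + 3 ^ k * t ≠ 0 := by omega
    rw [padicValNat.mul (by norm_num) (by omega), padicValNat.mul (by norm_num) (by omega)]
    simp
    omega
  · have hc : 3 ^ k % 2 = 1 := by have := three_pow_mod k; omega
    have hQ : ∀ t, 3 ^ kSucc k (μ + 8 * t) * mSucc k (μ + 8 * t) % 8 = 7 ↔
        QQ 2 (a + 3 ^ k * t) := by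
      intro t
      rw [← QQ_double 1, ← QQ_double 0, ← hn]
      simp [QQ, kSucc, mSucc]
    have hT : Tendsto (fun N : ℕ => (N + 8 - μ) / 8) atTop atTop := by
      rw [tendsto_atTop]
      intro b
      filter_upwards [eventually_ge_atTop (8 * b)] with N hN
      omega
    refine ((count_tendsto (3 ^ k) hc 2 a).comp hT).congr fun N => ?_
    have hd := card_num (fun _ => True) μ hμ'.1 hμ'.2 N
    simp only [and_true, Nat.count_true] at hd
    rw [hd, card_num _ μ hμ'.1 hμ'.2 N]
    simp only [hQ, Function.comp]
end

section
/- Let f(x) = (3x+1)/2. For every L ≥ 1 and every 1 ≤ g ≤ L, among the 2^L integers n ∈ {0, 1, …, 2^{L+2}−1} with n ≡ 3 (mod 4), exactly 2^{L−g} satisfy: f^{i}(n) ≡ 3 (mod 4) for all 0 ≤ i < g, and f^{g}(n) ≡ 1 (mod 4). (That is, the gap length G(n) — the least g ≥ 1 such that the g-th iterate of f leaves the residue class 3 mod 4 — equals g for exactly 2^{L−g} of these residues.) -/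
/-- The gap-phase step `f(x) = (3x+1)/2`. -/
def halfStep (x : ℕ) : ℕ := (3 * x + 1) / 2

theorem halfStep_char (g : ℕ) : ∀ n : ℕ,
    ((∀ i < g, halfStep^[i] n % 4 = 3) ∧ halfStep^[g] n % 4 = 1) ↔
      ∃ j, n + 1 = 2 ^ (g + 1) * (2 * j + 1) := by
  induction g with
  | zero =>
    intro n
    simp only [Nat.not_lt_zero, Function.iterate_zero, id]
    constructor
    · rintro ⟨-, h⟩
      exact ⟨n / 4, by omega⟩
    · rintro ⟨j, h⟩
      exact ⟨by simp, by omega⟩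
  | succ g ih =>
    intro n
    have h1 : ((∀ i < g + 1, halfStep^[i] n % 4 = 3) ∧ halfStep^[g + 1] n % 4 = 1) ↔
        n % 4 = 3 ∧ ((∀ i < g, halfStep^[i] (halfStep n) % 4 = 3) ∧
          halfStep^[g] (halfStep n) % 4 = 1) := by
      rw [Function.iterate_succ_apply]
      constructor
      · rintro ⟨a, b⟩
        refine ⟨by simpa using a 0 (by omega), ?_, b⟩
        intro i hi
        have := a (i + 1) (by omega)
        rwa [Function.iterate_succ_apply] at this
      · rintro ⟨a, b, c⟩
        refine ⟨?_, c⟩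
        intro i hi
        cases i with
        | zero => simpa using a
        | succ i =>
          rw [Function.iterate_succ_apply]
          exact b i (by omega)
    rw [h1, ih]
    constructor
    · rintro ⟨a, j, hj⟩
      have e : 2 * (halfStep n + 1) = 3 * (n + 1) := by unfold halfStep; omega
      have hd : 3 ∣ 2 ^ (g + 1) * (2 * j + 1) := by
        rw [← hj]; omega
      have hc : Nat.Coprime 3 (2 ^ (g + 1)) := Nat.Coprime.pow_right _ (by norm_num)
      obtain ⟨c, hc⟩ := hc.dvd_of_dvd_mul_left hd
      refine ⟨c / 2, ?_⟩
      have h2 : 2 * (c / 2) + 1 = c := by omega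
      rw [h2]
      rw [hj, hc] at e
      have : 2 ^ (g + 1 + 1) = 2 * 2 ^ (g + 1) := by ring
      rw [this]
      nlinarith
    · rintro ⟨j, hj⟩
      have h4 : n + 1 = 4 * (2 ^ g * (2 * j + 1)) := by rw [hj]; ring
      have a : n % 4 = 3 := by omega
      refine ⟨a, 3 * j + 1, ?_⟩
      have e : 2 * (halfStep n + 1) = 3 * (n + 1) := by unfold halfStep; omega
      rw [h4] at e
      have : 2 ^ (g + 1) * (2 * (3 * j + 1) + 1) = 6 * (2 ^ g * (2 * j + 1)) := by ring
      rw [this]; omega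

/-- Modular gap distribution: for `1 ≤ g ≤ L`, among the `2^L` integers
`n ∈ {0, …, 2^{L+2} − 1}` with `n ≡ 3 (mod 4)`, exactly `2^{L−g}` satisfy
`f^i(n) ≡ 3 (mod 4)` for all `0 ≤ i < g` and `f^g(n) ≡ 1 (mod 4)`,
i.e. have gap length exactly `g`. -/
theorem gap_length_count (L g : ℕ) (hL : 1 ≤ L) (hg1 : 1 ≤ g) (hgL : g ≤ L) :
    ((Finset.range (2 ^ (L + 2))).filter
        (fun n => n % 4 = 3 ∧ (∀ i < g, halfStep^[i] n % 4 = 3) ∧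
          halfStep^[g] n % 4 = 1)).card = 2 ^ (L - g) := by
  obtain ⟨d, rfl⟩ := Nat.exists_eq_add_of_le hgL
  have hs : g + d - g = d := by omega
  rw [hs]
  have hP : 0 < 2 ^ (g + 1) := by positivity
  have hpow : 2 ^ (g + d + 2) = 2 ^ (g + 1) * (2 * 2 ^ d) := by ring
  have key : (Finset.range (2 ^ (g + d + 2))).filter
        (fun n => n % 4 = 3 ∧ (∀ i < g, halfStep^[i] n % 4 = 3) ∧
          halfStep^[g] n % 4 = 1) =
      (Finset.range (2 ^ d)).image (fun j => 2 ^ (g + 1) * (2 * j + 1) - 1) := by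
    ext n
    simp only [Finset.mem_filter, Finset.mem_range, Finset.mem_image]
    constructor
    · rintro ⟨hn, -, h⟩
      obtain ⟨j, hj⟩ := (halfStep_char g n).1 h
      refine ⟨j, ?_, by omega⟩
      have : 2 ^ (g + 1) * (2 * j + 1) ≤ 2 ^ (g + 1) * (2 * 2 ^ d) := by omega
      have := Nat.le_of_mul_le_mul_left this hP
      omega
    · rintro ⟨j, hj, rfl⟩
      have hpos : 0 < 2 ^ (g + 1) * (2 * j + 1) := by positivity
      have hle : 2 ^ (g + 1) * (2 * j + 1) ≤ 2 ^ (g + 1) * (2 * 2 ^ d) :=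
        Nat.mul_le_mul_left _ (by omega)
      have h := (halfStep_char g (2 ^ (g + 1) * (2 * j + 1) - 1)).2 ⟨j, by omega⟩
      refine ⟨by omega, ?_, h⟩
      simpa using h.1 0 (by omega)
  rw [key, Finset.card_image_of_injective, Finset.card_range]
  intro a b hab
  have ha : 0 < 2 ^ (g + 1) * (2 * a + 1) := by positivity
  have hb : 0 < 2 ^ (g + 1) * (2 * b + 1) := by positivity
  have h : 2 ^ (g + 1) * (2 * a + 1) = 2 ^ (g + 1) * (2 * b + 1) := by
    simp only at hab
    omega
  have := Nat.eq_of_mul_eq_mul_left hP h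
  omega
end

section
/- Let S be the Syracuse map. For every m ≥ 1 and all positive integers b_0, …, b_{m−1} with B = b_0 + ⋯ + b_{m−1}, there exists an odd residue a modulo 2^{B+1} such that for every odd positive integer n: v₂(3·S^{j}(n) + 1) = b_j for all 0 ≤ j < m if and only if n ≡ a (mod 2^{B+1}). In other words, the set of odd n realizing a prescribed valuation block (b_0, …, b_{m−1}) is a single odd residue class modulo 2^{B+1}. -/
/-- The Syracuse (odd-to-odd Collatz) map `S(n) = (3n+1)/2^{v₂(3n+1)}`. -/
def syr (n : ℕ) : ℕ := (3 * n + 1) / 2 ^ padicValNat 2 (3 * n + 1)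

lemma key_step (n b K a : ℕ) (hK : 1 ≤ K) (haK : a < 2 ^ K) (ha : Odd a) :
    (padicValNat 2 (3 * n + 1) = b ∧ syr n % 2 ^ K = a) ↔
      3 * n + 1 ≡ 2 ^ b * a [MOD 2 ^ (b + K)] := by
  have hpos : 0 < 2 ^ b := by positivity
  have h2K : 2 ∣ 2 ^ K := dvd_pow_self 2 (by omega)
  constructor
  · rintro ⟨h1, h2⟩
    have hd : 2 ^ b ∣ 3 * n + 1 := by rw [← h1]; exact pow_padicValNat_dvd
    obtain ⟨s, hs⟩ := hd
    have hsy : syr n = s := by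
      unfold syr
      rw [h1, hs, Nat.mul_div_cancel_left _ hpos]
    rw [hsy] at h2
    rw [hs, pow_add]
    apply Nat.ModEq.mul_left'
    unfold Nat.ModEq
    rw [h2, Nat.mod_eq_of_lt haK]
  · intro h
    have hd : 2 ^ b ∣ 3 * n + 1 := by
      have h' : 3 * n + 1 ≡ 2 ^ b * a [MOD 2 ^ b] := h.of_dvd (pow_dvd_pow 2 (by omega))
      exact (h'.dvd_iff (dvd_refl _)).2 (dvd_mul_right _ _)
    obtain ⟨s, hs⟩ := hd
    rw [hs, pow_add] at h
    have hsa : s ≡ a [MOD 2 ^ K] := Nat.ModEq.mul_left_cancel' hpos.ne' h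
    have hs2 : ¬ 2 ∣ s := by
      rw [(hsa.dvd_iff h2K)]
      exact fun h => (Nat.not_even_iff_odd.2 ha) (even_iff_two_dvd.2 h)
    have hs0 : s ≠ 0 := by rintro rfl; simp at hs2
    have hv : padicValNat 2 (3 * n + 1) = b := by
      rw [hs, padicValNat.mul hpos.ne' hs0, padicValNat.prime_pow,
        padicValNat.eq_zero_of_not_dvd hs2, add_zero]
    refine ⟨hv, ?_⟩
    have hsy : syr n = s := by
      unfold syr
      rw [hv, hs, Nat.mul_div_cancel_left _ hpos]
    rw [hsy, ← Nat.mod_eq_of_lt haK]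
    exact hsa

lemma syr_odd (n : ℕ) : Odd (syr n) := by
  rw [← Nat.not_even_iff_odd, even_iff_two_dvd]
  intro h
  have h1 : 2 ^ padicValNat 2 (3 * n + 1) ∣ 3 * n + 1 := pow_padicValNat_dvd
  have h2 : 2 ^ (padicValNat 2 (3 * n + 1) + 1) ∣ 3 * n + 1 := by
    rw [pow_succ]
    exact (Nat.dvd_div_iff_mul_dvd h1).1 h
  exact pow_succ_padicValNat_not_dvd (by omega) h2

lemma solve_three (k c : ℕ) (hk : 1 ≤ k) (hc : 2 ∣ c) (hc0 : 0 < c) :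
    ∃ a : ℕ, a < 2 ^ k ∧ Odd a ∧ ∀ n : ℕ, 3 * n + 1 ≡ c [MOD 2 ^ k] ↔ n % 2 ^ k = a := by
  have h2 : 2 ∣ 2 ^ k := dvd_pow_self 2 (by omega)
  have hcop : Nat.Coprime 3 (2 ^ k) := Nat.Coprime.pow_right k (by norm_num)
  obtain ⟨t, ht⟩ : ∃ t, 3 * t ≡ 1 [MOD 2 ^ k] := by
    obtain ⟨t, -, ht⟩ := Nat.exists_mul_mod_eq_one_of_coprime hcop
      (Nat.one_lt_two_pow (by omega))
    exact ⟨t, by rw [Nat.ModEq, ht, Nat.mod_eq_of_lt (Nat.one_lt_two_pow (by omega))]⟩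
  obtain ⟨d, rfl⟩ : ∃ d, c = d + 1 := ⟨c - 1, by omega⟩
  have hx : 3 * (t * d) ≡ d [MOD 2 ^ k] := by
    have := ht.mul_right d
    rwa [one_mul, mul_assoc] at this
  refine ⟨(t * d) % 2 ^ k, Nat.mod_lt _ (by positivity), ?_, ?_⟩
  · have e1 : (t * d) % 2 ^ k ≡ t * d [MOD 2] := (Nat.mod_modEq _ _).of_dvd h2
    have e2 := hx.of_dvd h2
    rw [Nat.odd_iff]
    unfold Nat.ModEq at e1 e2
    omega
  · intro n
    constructor
    · intro h
      have h' : 3 * n ≡ d [MOD 2 ^ k] := Nat.ModEq.add_right_cancel' 1 h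
      exact Nat.ModEq.cancel_left_of_coprime (by simpa using hcop.symm) (h'.trans hx.symm)
    · intro h
      have h' : n ≡ t * d [MOD 2 ^ k] := h
      exact ((h'.mul_left 3).trans hx).add_right 1

lemma block_aux (m : ℕ) : ∀ (b : ℕ → ℕ), (∀ j < m, 1 ≤ b j) →
    ∃ a : ℕ, a < 2 ^ ((∑ j ∈ Finset.range m, b j) + 1) ∧ Odd a ∧
      ∀ n : ℕ, Odd n →
        ((∀ j < m, padicValNat 2 (3 * syr^[j] n + 1) = b j) ↔
          n % 2 ^ ((∑ j ∈ Finset.range m, b j) + 1) = a) := by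
  induction m with
  | zero =>
    intro b _
    refine ⟨1, by simp, odd_one, fun n hn => ?_⟩
    simpa using Nat.odd_iff.1 hn
  | succ m ih =>
    intro b hb
    obtain ⟨a', hlt, hodd, H⟩ := ih (fun j => b (j + 1)) (fun j hj => hb (j + 1) (by omega))
    have hb0 := hb 0 (by omega)
    set B := ∑ j ∈ Finset.range m, b (j + 1) with hB
    have hsum : (∑ j ∈ Finset.range (m + 1), b j) + 1 = b 0 + (B + 1) := by
      rw [Finset.sum_range_succ']; omega
    rw [hsum]
    obtain ⟨a, h1, h2, h3⟩ := solve_three (b 0 + (B + 1)) (2 ^ b 0 * a') (by omega)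
      ((dvd_pow_self 2 (by omega)).mul_right _) (Nat.mul_pos (by positivity) hodd.pos)
    refine ⟨a, h1, h2, fun n _ => ?_⟩
    rw [← h3, ← key_step n (b 0) (B + 1) a' (by omega) hlt hodd, ← H _ (syr_odd n)]
    constructor
    · intro h
      exact ⟨h 0 (by omega), fun j hj => h (j + 1) (by omega)⟩
    · rintro ⟨h0, hs⟩ j hj
      cases j with
      | zero => exact h0
      | succ j => exact hs j (by omega)

/-- Exact block law: for any prescribed valuation block `(b 0, …, b (m−1))` of positive
integers with total `B = b 0 + ⋯ + b (m−1)`, there is a single odd residue class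
`a (mod 2^{B+1})` such that an odd positive `n` realizes the block
(`v₂(3·S^j(n)+1) = b j` for all `j < m`) iff `n ≡ a (mod 2^{B+1})`. -/
theorem exact_block_law (m : ℕ) (hm : 1 ≤ m) (b : ℕ → ℕ) (hb : ∀ j < m, 1 ≤ b j) :
    ∃ a : ℕ, a < 2 ^ ((∑ j ∈ Finset.range m, b j) + 1) ∧ Odd a ∧
      ∀ n : ℕ, 0 < n → Odd n →
        ((∀ j < m, padicValNat 2 (3 * syr^[j] n + 1) = b j) ↔
          n % 2 ^ ((∑ j ∈ Finset.range m, b j) + 1) = a) := by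
  obtain ⟨a, h1, h2, h3⟩ := block_aux m b hb
  exact ⟨a, h1, h2, fun n _ hn => h3 n hn⟩
end

section
/- Let S be the Syracuse map and let n be an odd positive integer with L = v₂(n+1) − 1. Then: (1) for all 0 ≤ j < L, v₂(3·S^{j}(n)+1) = 1; (2) for all 0 ≤ j ≤ L, S^{j}(n) = 3^j·(n+1)/2^j − 1 (in particular 2^j divides 3^j·(n+1)); (3) S^{L}(n) ≡ 1 (mod 4), so v₂(3·S^{L}(n)+1) ≥ 2. Thus the initial run of Syracuse steps with 2-adic valuation 1 has length exactly L = v₂(n+1) − 1, and the net growth factor over the run is (3/2)^L. -/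
theorem val_one_aux (a : ℕ) (h : a % 4 = 3) : padicValNat 2 (3 * a + 1) = 1 := by
  have h1 : 1 ≤ padicValNat 2 (3 * a + 1) :=
    (padicValNat_dvd_iff_le (by omega)).1 (by omega)
  have h2 : ¬ 2 ≤ padicValNat 2 (3 * a + 1) := fun h2 => by
    have := (padicValNat_dvd_iff_le (p := 2) (by omega)).2 h2
    omega
  omega

theorem syr_iter_aux (n L m : ℕ) (h : n + 1 = 2 ^ (L + 1) * m) :
    ∀ j k, j + k = L → syr^[j] n + 1 = 3 ^ j * (2 ^ (k + 1) * m) := by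
  intro j
  induction j with
  | zero => intro k hk; obtain rfl : k = L := by omega
            simpa using h
  | succ j ih =>
    intro k hk
    have h1 := ih (k + 1) (by omega)
    have h2 : 3 ^ j * (2 ^ (k + 1 + 1) * m) = 4 * (3 ^ j * (2 ^ k * m)) := by ring
    have h3 : 3 ^ (j + 1) * (2 ^ (k + 1) * m) = 6 * (3 ^ j * (2 ^ k * m)) := by ring
    rw [h2] at h1
    rw [h3, Function.iterate_succ_apply', syr, val_one_aux _ (by omega)]
    omega

/-- Run-length invariant: for odd positive `n` with `L = v₂(n+1) − 1`:
(1) `v₂(3·S^j(n)+1) = 1` for all `j < L`;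
(2) `2^j ∣ 3^j·(n+1)` and `S^j(n) = 3^j·(n+1)/2^j − 1` for all `j ≤ L`;
(3) `S^L(n) ≡ 1 (mod 4)`, hence `v₂(3·S^L(n)+1) ≥ 2`. -/
theorem run_length_invariant (n : ℕ) (hn : 0 < n) (hodd : Odd n)
    (L : ℕ) (hL : L = padicValNat 2 (n + 1) - 1) :
    (∀ j < L, padicValNat 2 (3 * syr^[j] n + 1) = 1) ∧
    (∀ j ≤ L, 2 ^ j ∣ 3 ^ j * (n + 1) ∧ syr^[j] n = 3 ^ j * (n + 1) / 2 ^ j - 1) ∧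
    syr^[L] n % 4 = 1 ∧ 2 ≤ padicValNat 2 (3 * syr^[L] n + 1) := by
  have h1 : 1 ≤ padicValNat 2 (n + 1) :=
    (padicValNat_dvd_iff_le (by omega)).1 (by obtain ⟨k, rfl⟩ := hodd; omega)
  have hv : padicValNat 2 (n + 1) = L + 1 := by omega
  obtain ⟨m, hm⟩ : 2 ^ (L + 1) ∣ n + 1 := (padicValNat_dvd_iff_le (by omega)).2 hv.ge
  have hmo : m % 2 = 1 := by
    by_contra hc
    obtain ⟨t, rfl⟩ : 2 ∣ m := by omega
    have : L + 1 + 1 ≤ padicValNat 2 (n + 1) :=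
      (padicValNat_dvd_iff_le (by omega)).1 ⟨t, by rw [hm]; ring⟩
    omega
  have key := syr_iter_aux n L m hm
  have h4 : syr^[L] n % 4 = 1 := by
    have h := key L 0 rfl
    have h2 : 3 ^ L * (2 ^ (0 + 1) * m) = 2 * (3 ^ L * m) := by ring
    have h3 : (3 ^ L * m) % 2 = 1 :=
      Nat.odd_iff.1 (((by decide : Odd 3).pow).mul (Nat.odd_iff.2 hmo))
    omega
  refine ⟨fun j hj => ?_, fun j hj => ?_, h4, ?_⟩
  · apply val_one_aux
    obtain ⟨k, rfl⟩ := Nat.exists_eq_add_of_lt hj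
    have h := key j (k + 1) (by omega)
    have h2 : 3 ^ j * (2 ^ (k + 1 + 1) * m) = 4 * (3 ^ j * (2 ^ k * m)) := by ring
    omega
  · obtain ⟨k, rfl⟩ := Nat.exists_eq_add_of_le hj
    have h := key j k rfl
    have h2 : 3 ^ j * (n + 1) = 2 ^ j * (3 ^ j * (2 ^ (k + 1) * m)) := by rw [hm]; ring
    refine ⟨⟨_, h2⟩, ?_⟩
    rw [h2, Nat.mul_div_cancel_left _ (by positivity), ← h]
    omega
  · exact (padicValNat_dvd_iff_le (by omega)).1 (by omega)
end

section
/- Let S be the Syracuse map, let n be an odd positive integer, L = v₂(n+1) − 1, and r = v₂(3·S^{L}(n) + 1) (so r ≥ 2). Then 2^{L+r} divides 3^{L+1}(n+1) − 2^{L+1} and S^{L+1}(n) = (3^{L+1}(n+1) − 2^{L+1})/2^{L+r}. Moreover: (1) if 2^{L+r} ≤ 3^{L+1}, then S^{L+1}(n) ≥ n; (2) if 2^{L+r} > 3^{L+1}, then S^{L+1}(n) < n if and only if n·(2^{L+r} − 3^{L+1}) > 3^{L+1} − 2^{L+1}. -/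
theorem syr_mul (m : ℕ) : 2 ^ padicValNat 2 (3 * m + 1) * syr m = 3 * m + 1 :=
  Nat.mul_div_cancel' pow_padicValNat_dvd

theorem syr_step (m k : ℕ) (h : m + 1 = 4 * k) : syr m + 1 = 6 * k := by
  have hv : padicValNat 2 (3 * m + 1) = 1 := by
    have h1 : 3 * m + 1 = 2 * (6 * k - 1) := by omega
    rw [h1, padicValNat.mul (by norm_num) (by omega), padicValNat.self (by norm_num),
      padicValNat.eq_zero_of_not_dvd (by omega)]
  have := syr_mul m
  rw [hv] at this
  omega

theorem syr_run (L : ℕ) : ∀ n q : ℕ, n + 1 = 2 ^ (L + 1) * q →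
    syr^[L] n + 1 = 2 * 3 ^ L * q := by
  induction L with
  | zero => intro n q h; simpa using h
  | succ L ih =>
    intro n q h
    rw [Function.iterate_succ_apply, ih (syr n) (3 * q)]
    · ring
    · rw [syr_step n (2 ^ L * q) (by rw [h]; ring)]
      ring

/-- Exact one-cycle crossing criterion: for odd positive `n` with
`L = v₂(n+1) − 1` and `r = v₂(3·S^L(n)+1)` one has `r ≥ 2`,
`2^{L+r} ∣ 3^{L+1}(n+1) − 2^{L+1}`, and
`S^{L+1}(n) = (3^{L+1}(n+1) − 2^{L+1})/2^{L+r}`; moreover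
(1) if `2^{L+r} ≤ 3^{L+1}` then `S^{L+1}(n) ≥ n`, and
(2) if `2^{L+r} > 3^{L+1}` then `S^{L+1}(n) < n ↔ n·(2^{L+r} − 3^{L+1}) > 3^{L+1} − 2^{L+1}`. -/
theorem one_cycle_crossing (n : ℕ) (hn : 0 < n) (hodd : Odd n)
    (L r : ℕ) (hL : L = padicValNat 2 (n + 1) - 1)
    (hr : r = padicValNat 2 (3 * syr^[L] n + 1)) :
    2 ≤ r ∧
    2 ^ (L + r) ∣ 3 ^ (L + 1) * (n + 1) - 2 ^ (L + 1) ∧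
    syr^[L + 1] n = (3 ^ (L + 1) * (n + 1) - 2 ^ (L + 1)) / 2 ^ (L + r) ∧
    (2 ^ (L + r) ≤ 3 ^ (L + 1) → n ≤ syr^[L + 1] n) ∧
    (3 ^ (L + 1) < 2 ^ (L + r) →
      (syr^[L + 1] n < n ↔ 3 ^ (L + 1) - 2 ^ (L + 1) < n * (2 ^ (L + r) - 3 ^ (L + 1)))) := by
  have h2 : 2 ∣ n + 1 := by
    obtain ⟨k, hk⟩ := hodd
    omega
  have hv : 1 ≤ padicValNat 2 (n + 1) :=
    one_le_padicValNat_of_dvd (by omega) h2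
  have hL1 : L + 1 = padicValNat 2 (n + 1) := by omega
  obtain ⟨q, hq⟩ : 2 ^ (L + 1) ∣ n + 1 := hL1 ▸ pow_padicValNat_dvd
  have hqodd : Odd q := by
    by_contra hc
    rw [Nat.not_odd_iff_even] at hc
    obtain ⟨c, hc⟩ := hc
    apply pow_succ_padicValNat_not_dvd (p := 2) (n := n + 1) (by omega)
    rw [← hL1]
    exact ⟨c, by rw [hq, hc]; ring⟩
  have hm := syr_run L n q hq
  have hs := syr_mul (syr^[L] n)
  rw [← hr, ← Function.iterate_succ_apply' syr L n] at hs
  have hodd3 : Odd (3 ^ (L + 1) * q) := (Odd.pow (by decide)).mul hqodd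
  have h4 : 4 ∣ 3 * syr^[L] n + 1 := by
    obtain ⟨c, hc⟩ := hodd3
    have : 2 * 3 ^ L * q * 3 = 2 * (2 * c + 1) := by rw [← hc]; ring
    omega
  have hr2 : 2 ≤ r := by
    rw [hr]
    exact (padicValNat_dvd_iff_le (p := 2) (n := 2) (by omega)).1 (by simpa using h4)
  have key : 3 ^ (L + 1) * (n + 1) = 2 ^ (L + r) * syr^[L + 1] n + 2 ^ (L + 1) := by
    have e : 2 ^ (L + r) * syr^[L + 1] n = 2 ^ L * (3 * syr^[L] n + 1) := by
      rw [← hs]; ring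
    rw [e, hq]
    calc 3 ^ (L + 1) * (2 ^ (L + 1) * q) = 3 * 2 ^ L * (2 * 3 ^ L * q) := by ring
      _ = 2 ^ L * (3 * syr^[L] n + 1) + 2 ^ (L + 1) := by rw [← hm]; ring
  have hsub : 3 ^ (L + 1) * (n + 1) - 2 ^ (L + 1) = 2 ^ (L + r) * syr^[L + 1] n := by omega
  have hpos : 0 < 2 ^ (L + r) := by positivity
  have h32 : 2 ^ (L + 1) ≤ 3 ^ (L + 1) := Nat.pow_le_pow_left (by norm_num) _
  refine ⟨hr2, ⟨_, hsub⟩, ?_, ?_, ?_⟩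
  · rw [hsub, Nat.mul_div_cancel_left _ hpos]
  · intro h
    refine Nat.le_of_mul_le_mul_left ?_ hpos
    have := Nat.mul_le_mul_right n h
    rw [mul_add] at key
    omega
  · intro h
    rw [← Nat.mul_lt_mul_left hpos, Nat.mul_sub, mul_comm n, mul_comm n]
    have := Nat.mul_le_mul_right n h.le
    rw [mul_add] at key
    omega
end

section
/- Let S be the Syracuse map and let k ≥ 2. Starting from n₀ = 2^{k+1} − 1, one has S^{k}(n₀) = 2·3^k − 1, and the valuation of the next step is v₂(3·S^{k}(n₀) + 1) = 2 if k is even, and v₂(3·S^{k}(n₀) + 1) = 3 + v₂(k+1) if k is odd. In particular this valuation is always ≥ 2, and is ≥ 4 whenever k is odd. -/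
lemma val_two_mul_odd (m : ℕ) (hm : m % 2 = 1) : padicValNat 2 (2 * m) = 1 := by
  rw [padicValNat.mul (by norm_num) (by omega), padicValNat.self (by norm_num),
    padicValNat.eq_zero_of_not_dvd (by omega)]

lemma syr_step_s8 (m : ℕ) (hm : 1 ≤ m) : syr (4 * m - 1) = 6 * m - 1 := by
  have h : 3 * (4 * m - 1) + 1 = 2 * (6 * m - 1) := by omega
  unfold syr
  rw [h, val_two_mul_odd _ (by omega)]
  omega

lemma syr_iter (j : ℕ) : ∀ c : ℕ, 1 ≤ c → syr^[j] (2 ^ (j + 1) * c - 1) = 2 * 3 ^ j * c - 1 := by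
  induction j with
  | zero => intro c _; simp
  | succ j ih =>
    intro c hc
    have e1 : 2 ^ (j + 1 + 1) * c = 4 * (2 ^ j * c) := by ring
    have e2 : 6 * (2 ^ j * c) = 2 ^ (j + 1) * (3 * c) := by ring
    have hp : 1 ≤ 2 ^ j * c := Nat.mul_pos (by positivity) hc
    rw [Function.iterate_succ_apply, e1, syr_step_s8 _ hp, e2, ih _ (by omega)]
    congr 1
    ring

/-- Post-Mersenne forced valuation: starting from `n₀ = 2^{k+1} − 1` (`k ≥ 2`) one has
`S^k(n₀) = 2·3^k − 1`, and `v₂(3·S^k(n₀)+1) = 2` if `k` is even,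
`= 3 + v₂(k+1)` if `k` is odd; in particular it is always `≥ 2`, and `≥ 4` for odd `k`. -/
theorem post_mersenne_forced_valuation (k : ℕ) (hk : 2 ≤ k) :
    syr^[k] (2 ^ (k + 1) - 1) = 2 * 3 ^ k - 1 ∧
    (Even k → padicValNat 2 (3 * syr^[k] (2 ^ (k + 1) - 1) + 1) = 2) ∧
    (Odd k → padicValNat 2 (3 * syr^[k] (2 ^ (k + 1) - 1) + 1) = 3 + padicValNat 2 (k + 1)) ∧
    2 ≤ padicValNat 2 (3 * syr^[k] (2 ^ (k + 1) - 1) + 1) ∧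
    (Odd k → 4 ≤ padicValNat 2 (3 * syr^[k] (2 ^ (k + 1) - 1) + 1)) := by
  have h1 : syr^[k] (2 ^ (k + 1) - 1) = 2 * 3 ^ k - 1 := by
    simpa using syr_iter k 1 le_rfl
  have hpos : 1 ≤ 3 ^ k := Nat.one_le_pow _ _ (by norm_num)
  have h2 : 3 * (2 * 3 ^ k - 1) + 1 = 2 * (3 ^ (k + 1) - 1) := by
    rw [pow_succ]; omega
  have hev : Even k → padicValNat 2 (3 * (2 * 3 ^ k - 1) + 1) = 2 := by
    rintro ⟨r, rfl⟩
    have h8 : 3 ^ (r + r) % 4 = 1 := by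
      rw [← two_mul, pow_mul, Nat.pow_mod]; norm_num
    obtain ⟨m, hm, hm2⟩ : ∃ m, 3 ^ (r + r + 1) - 1 = 2 * m ∧ m % 2 = 1 :=
      ⟨(3 ^ (r + r + 1) - 1) / 2, by rw [pow_succ]; omega, by rw [pow_succ]; omega⟩
    rw [h2, hm, padicValNat.mul (by norm_num) (by omega), padicValNat.self (by norm_num),
      val_two_mul_odd _ hm2]
  have hod : Odd k → padicValNat 2 (3 * (2 * 3 ^ k - 1) + 1) = 3 + padicValNat 2 (k + 1) := by
    intro ho
    have hl := padicValNat.pow_two_sub_pow (x := 3) (y := 1) (by norm_num) (by norm_num)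
      (by norm_num) (n := k + 1) (by omega) ho.add_one
    have h4 : padicValNat 2 4 = 2 := padicValNat.prime_pow (p := 2) 2
    have h22 : padicValNat 2 2 = 1 := padicValNat.self (by norm_num)
    norm_num [h4, h22] at hl
    rw [h2, padicValNat.mul (by norm_num) (by rw [pow_succ]; omega), h22]
    omega
  have hod4 : Odd k → 4 ≤ padicValNat 2 (3 * (2 * 3 ^ k - 1) + 1) := by
    intro ho
    have : 1 ≤ padicValNat 2 (k + 1) :=
      one_le_padicValNat_of_dvd (by omega) ho.add_one.two_dvd
    rw [hod ho]; omega
  rw [h1]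
  refine ⟨rfl, hev, hod, ?_, hod4⟩
  rcases Nat.even_or_odd k with h | h
  · exact (hev h).ge
  · have := hod4 h
    omega
end

section
/- Let τ = (a_0, …, a_{p−1}) and η = (b_0, …, b_{t−1}) be finite words of positive integers that agree on their first r entries (a_j = b_j for all j < r) but differ at position r (so r < p, r < t, and a_r ≠ b_r). Set M_r = a_0 + ⋯ + a_{r−1}, D_τ = 2^{K(τ)} − 3^p, D_η = 2^{K(η)} − 3^t, and define the defect E(τ,η) = C(η)·D_τ − C(τ)·D_η. Then E(τ,η) ≠ 0 and v₂(E(τ,η)) = M_r + min(a_r, b_r). -/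
/-- Weight `K(w) = w 0 + ⋯ + w (L−1)` of a finite word of naturals. -/
def wordWt (L : ℕ) (w : ℕ → ℕ) : ℕ := ∑ i ∈ Finset.range L, w i

/-- Carry constant `C(w) = Σ_{j<L} 3^{L−1−j}·2^{w 0 + ⋯ + w (j−1)}` of a finite word. -/
def wordCarry (L : ℕ) (w : ℕ → ℕ) : ℕ :=
  ∑ j ∈ Finset.range L, 3 ^ (L - 1 - j) * 2 ^ (∑ i ∈ Finset.range j, w i)

theorem wc_succ (L : ℕ) (w : ℕ → ℕ) :
    wordCarry (L+1) w = 3 * wordCarry L w + 2 ^ wordWt L w := by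
  unfold wordCarry wordWt
  rw [Finset.sum_range_succ, Finset.mul_sum]
  congr 1
  · apply Finset.sum_congr rfl
    intro j hj
    have hj := Finset.mem_range.mp hj
    have : L + 1 - 1 - j = (L - 1 - j) + 1 := by omega
    rw [this, pow_succ]; ring
  · simp

theorem wt_add (m k : ℕ) (w : ℕ → ℕ) :
    wordWt (m+k) w = wordWt m w + wordWt k (fun i => w (m+i)) := by
  unfold wordWt
  rw [Finset.sum_range_add]

theorem wc_add (m k : ℕ) (w : ℕ → ℕ) :
    wordCarry (m+k) w = 3^k * wordCarry m w
      + 2 ^ wordWt m w * wordCarry k (fun i => w (m+i)) := by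
  induction k with
  | zero => simp [wordCarry]
  | succ k ih =>
    rw [← add_assoc, wc_succ, wc_succ, ih, wt_add, pow_add, pow_succ]; ring

theorem wt_pos (L : ℕ) (w : ℕ → ℕ) (hL : 0 < L) (h : ∀ j < L, 1 ≤ w j) :
    wordWt L w ≠ 0 := by
  unfold wordWt
  have := Finset.single_le_sum (f := w) (fun i _ => Nat.zero_le _) (Finset.mem_range.mpr hL)
  have := h 0 hL
  omega

theorem wc_odd (L : ℕ) (w : ℕ → ℕ) (hL : 0 < L) (h : ∀ j < L, 1 ≤ w j) :
    Odd (wordCarry L w) := by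
  induction L with
  | zero => omega
  | succ L ih =>
    rw [wc_succ]
    rcases Nat.eq_zero_or_pos L with rfl | hp
    · simp [wordCarry, wordWt]
    · have h1 := ih hp (fun j hj => h j (by omega))
      have h2 := wt_pos L w hp (fun j hj => h j (by omega))
      exact (Odd.mul (by decide) h1).add_even ((even_two).pow_of_ne_zero h2)

theorem key (p m : ℕ) (w : ℕ → ℕ) (hm : 0 < m) (hmp : m ≤ p) (h : ∀ j < p, 1 ≤ w j) :
    ∃ Y : ℤ, Odd Y ∧ (3:ℤ)^m * wordCarry p w + ((2:ℤ)^wordWt p w - 3^p) * wordCarry m w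
      = 2 ^ wordWt m w * Y := by
  obtain ⟨k, rfl⟩ := Nat.exists_eq_add_of_le hmp
  refine ⟨3^m * (wordCarry k (fun i => w (m+i)) : ℤ)
    + 2 ^ wordWt k (fun i => w (m+i)) * (wordCarry m w : ℤ), ?_, ?_⟩
  · have o3 : Odd ((3:ℤ)^m) := Odd.pow (by decide)
    have om : Odd (wordCarry m w : ℤ) := by
      exact_mod_cast wc_odd m w hm (fun j hj => h j (by omega))
    rcases Nat.eq_zero_or_pos k with rfl | hk
    · simpa [wordCarry, wordWt] using om
    · have ok : Odd (wordCarry k (fun i => w (m+i)) : ℤ) := by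
        exact_mod_cast wc_odd k _ hk (fun j hj => h (m+j) (by omega))
      have := wt_pos k (fun i => w (m+i)) hk (fun j hj => h (m+j) (by omega))
      exact (o3.mul ok).add_even (((even_two).pow_of_ne_zero this).mul_right _)
  · rw [wc_add, wt_add]; push_cast; ring

theorem fin_val (E Z : ℤ) (m s : ℕ) (hZ : Odd Z) (h : 3^m * E = 2^s * Z) :
    E ≠ 0 ∧ padicValInt 2 E = s := by
  have hZ0 : Z ≠ 0 := by rintro rfl; simp at hZ
  have hE : E ≠ 0 := by
    rintro rfl
    have : (2:ℤ)^s * Z ≠ 0 := by positivity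
    apply this; rw [← h]; simp
  refine ⟨hE, ?_⟩
  have hc : IsCoprime ((2:ℤ)^s) (3^m) := IsCoprime.pow ⟨-1, 1, by norm_num⟩
  obtain ⟨F, rfl⟩ : (2:ℤ)^s ∣ E := hc.dvd_of_dvd_mul_left ⟨Z, h⟩
  have hF : 3^m * F = Z := by
    have : (2:ℤ)^s ≠ 0 := by positivity
    apply mul_left_cancel₀ this
    rw [← h]; ring
  have oF : Odd F := by rw [← hF] at hZ; exact (Int.odd_mul.mp hZ).2
  have hF0 : F ≠ 0 := by rintro rfl; simp at oF
  have : Fact (Nat.Prime 2) := ⟨Nat.prime_two⟩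
  rw [padicValInt.mul (by positivity) hF0]
  have h1 : padicValInt 2 F = 0 := by
    apply padicValInt.eq_zero_of_not_dvd
    intro hd
    exact (Int.not_even_iff_odd.mpr oF) (even_iff_two_dvd.mpr (by exact_mod_cast hd))
  have h2 : padicValInt 2 ((2:ℤ)^s) = s := by
    simp [padicValInt, Int.natAbs_pow]
  rw [h1, h2, add_zero]

/-- First-mismatch valuation formula: if the words `a` (length `p`) and `b` (length `t`)
of positive integers agree on their first `r` entries and differ at position `r`, then
the defect `E = C(b)·(2^{K(a)} − 3^p) − C(a)·(2^{K(b)} − 3^t)` is nonzero with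
`v₂(E) = (a 0 + ⋯ + a (r−1)) + min (a r) (b r)`. -/
theorem first_mismatch_valuation (p t r : ℕ) (a b : ℕ → ℕ)
    (ha : ∀ j < p, 1 ≤ a j) (hb : ∀ j < t, 1 ≤ b j)
    (hrp : r < p) (hrt : r < t)
    (hagree : ∀ j < r, a j = b j) (hmismatch : a r ≠ b r) :
    (wordCarry t b : ℤ) * ((2 : ℤ) ^ wordWt p a - 3 ^ p) -
        (wordCarry p a : ℤ) * ((2 : ℤ) ^ wordWt t b - 3 ^ t) ≠ 0 ∧
    padicValInt 2
        ((wordCarry t b : ℤ) * ((2 : ℤ) ^ wordWt p a - 3 ^ p) -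
          (wordCarry p a : ℤ) * ((2 : ℤ) ^ wordWt t b - 3 ^ t)) =
      (∑ i ∈ Finset.range r, a i) + min (a r) (b r) := by
  have hS : wordWt r b = wordWt r a := by
    unfold wordWt
    exact Finset.sum_congr rfl (fun j hj => (hagree j (Finset.mem_range.mp hj)).symm)
  have hC : wordCarry (r+1) b = wordCarry (r+1) a := by
    unfold wordCarry
    apply Finset.sum_congr rfl
    intro j hj
    have hj := Finset.mem_range.mp hj
    congr 2
    apply Finset.sum_congr rfl
    intro i hi
    have hi := Finset.mem_range.mp hi
    exact (hagree i (by omega)).symm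
  obtain ⟨Ya, oa, ea⟩ := key p (r+1) a (by omega) hrp ha
  obtain ⟨Yb, ob, eb⟩ := key t (r+1) b (by omega) hrt hb
  have oDa : Odd ((2:ℤ)^wordWt p a - 3^p) :=
    ((even_two).pow_of_ne_zero (wt_pos p a (by omega) ha)).sub_odd (Odd.pow (by decide))
  have oDb : Odd ((2:ℤ)^wordWt t b - 3^t) :=
    ((even_two).pow_of_ne_zero (wt_pos t b (by omega) hb)).sub_odd (Odd.pow (by decide))
  have wa : wordWt (r+1) a = wordWt r a + a r := Finset.sum_range_succ _ _
  have wb : wordWt (r+1) b = wordWt r a + b r := by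
    rw [← hS]; exact Finset.sum_range_succ _ _
  rw [hC, wb] at eb
  rw [wa] at ea
  change _ ∧ _ = wordWt r a + min (a r) (b r)
  generalize (2:ℤ)^wordWt p a - 3^p = Da at *
  generalize (2:ℤ)^wordWt t b - 3^t = Db at *
  rcases lt_or_gt_of_ne hmismatch with hlt | hlt
  · obtain ⟨d, hd⟩ := Nat.exists_eq_add_of_lt hlt
    rw [min_eq_left hlt.le]
    apply fin_val _ (2^(d+1) * (Yb * Da) - Ya * Db) (r+1)
    · exact (((even_two).pow_of_ne_zero (by omega)).mul_right _).sub_odd (oa.mul oDb)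
    · rw [hd] at eb
      simp only [pow_add] at *
      linear_combination Da * eb - Db * ea
  · obtain ⟨d, hd⟩ := Nat.exists_eq_add_of_lt hlt
    rw [min_eq_right hlt.le]
    apply fin_val _ (Yb * Da - 2^(d+1) * (Ya * Db)) (r+1)
    · exact (ob.mul oDa).sub_even (((even_two).pow_of_ne_zero (by omega)).mul_right _)
    · rw [hd] at ea
      simp only [pow_add] at *
      linear_combination Da * eb - Db * ea
end

section
/- Let τ be a word of positive integers of length p ≥ 1 with weight K_p = K(τ) and carry constant C_p = C(τ), let η be a (possibly empty) word of positive integers of length t ≥ 0 with weight K_η = K(η) and carry constant C_η = C(η), and let q ≥ 1. Let σ = τ^q η (q copies of τ followed by η), a word of length ℓ = qp + t and weight K = q·K_p + K_η, with carry constant C_ℓ = C(σ). Setting D = 2^K − 3^ℓ, D_p = 2^{K_p} − 3^p, and D_η = 2^{K_η} − 3^t, one has the exact identity C_ℓ·D_p − C_p·D = 2^{q·K_p}·(C_η·D_p − C_p·D_η). In particular, if η is empty (σ = τ^q), then C_ℓ·D_p = C_p·D. -/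
/-- The word `τ^q η`: `q` copies of `τ = (a 0, …, a (p−1))` followed by
`η = (b 0, …, b (t−1))`. -/
def concatPow (p q : ℕ) (a b : ℕ → ℕ) : ℕ → ℕ :=
  fun i => if i < q * p then a (i % p) else b (i - q * p)

theorem wordCarry_succ' (L : ℕ) (w : ℕ → ℕ) :
    wordCarry (L + 1) w = 3 * wordCarry L w + 2 ^ wordWt L w := by
  unfold wordCarry wordWt
  rw [Finset.sum_range_succ, Finset.mul_sum]
  congr 1
  · apply Finset.sum_congr rfl
    intro j hj
    have hj' := Finset.mem_range.mp hj
    have : L + 1 - 1 - j = (L - 1 - j) + 1 := by omega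
    rw [this, pow_succ]
    ring
  · simp

theorem wordCarry_add' (m n : ℕ) (w : ℕ → ℕ) :
    wordCarry (m + n) w =
      3 ^ n * wordCarry m w + 2 ^ wordWt m w * wordCarry n (fun i => w (m + i)) := by
  induction n with
  | zero => simp [wordCarry]
  | succ n ih =>
    have h : wordWt (m + n) w = wordWt m w + wordWt n (fun i => w (m + i)) := by
      unfold wordWt
      exact Finset.sum_range_add _ _ _
    rw [← add_assoc, wordCarry_succ', ih, wordCarry_succ', h]
    ring

theorem wordWt_congr' (L : ℕ) (v w : ℕ → ℕ) (h : ∀ i < L, v i = w i) :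
    wordWt L v = wordWt L w :=
  Finset.sum_congr rfl (fun i hi => h i (Finset.mem_range.mp hi))

theorem wordCarry_congr' (L : ℕ) (v w : ℕ → ℕ) (h : ∀ i < L, v i = w i) :
    wordCarry L v = wordCarry L w := by
  induction L with
  | zero => simp [wordCarry]
  | succ n ih =>
    rw [wordCarry_succ', wordCarry_succ', ih (fun i hi => h i (by omega)),
      wordWt_congr' n v w (fun i hi => h i (by omega))]

theorem concatPow_shift' (p q : ℕ) (a b : ℕ → ℕ) :
    (fun i => concatPow p (q + 1) a b (p + i)) = concatPow p q a b := by
  funext i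
  have e : (q + 1) * p = p + q * p := by ring
  simp only [concatPow, e, Nat.add_mod_left, Nat.add_lt_add_iff_left, Nat.add_sub_add_left]

theorem core_identity' (p t q : ℕ) (a b : ℕ → ℕ) :
    (wordCarry (q * p + t) (concatPow p q a b) : ℤ) * ((2 : ℤ) ^ wordWt p a - 3 ^ p) -
        (wordCarry p a : ℤ) *
          ((2 : ℤ) ^ (q * wordWt p a + wordWt t b) - 3 ^ (q * p + t)) =
      2 ^ (q * wordWt p a) *
        ((wordCarry t b : ℤ) * ((2 : ℤ) ^ wordWt p a - 3 ^ p) -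
          (wordCarry p a : ℤ) * ((2 : ℤ) ^ wordWt t b - 3 ^ t)) := by
  induction q with
  | zero =>
    have : concatPow p 0 a b = b := by funext i; simp [concatPow]
    simp [this]
  | succ q ih =>
    have e : (q + 1) * p + t = p + (q * p + t) := by ring
    have hc : ∀ i < p, concatPow p (q + 1) a b i = a i := by
      intro i hi
      have : i < (q + 1) * p := by nlinarith [Nat.zero_le (q * p)]
      simp [concatPow, this, Nat.mod_eq_of_lt hi]
    have e2 : (q + 1) * wordWt p a + wordWt t b
        = wordWt p a + (q * wordWt p a + wordWt t b) := by ring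
    have e3 : (q + 1) * wordWt p a = wordWt p a + q * wordWt p a := by ring
    rw [e, e2, e3, wordCarry_add', concatPow_shift', wordCarry_congr' p _ a hc,
      wordWt_congr' p _ a hc, pow_add (2 : ℤ) (wordWt p a) (q * wordWt p a),
      mul_assoc, ← ih, pow_add (2 : ℤ) (wordWt p a), pow_add (3 : ℤ) p]
    push_cast
    ring

/-- Periodic-core factorization: for `σ = τ^q η` of length `ℓ = qp + t` and weight
`K = q·K_p + K_η`, with `D = 2^K − 3^ℓ`, `D_p = 2^{K_p} − 3^p`, `D_η = 2^{K_η} − 3^t`,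
one has `C_ℓ·D_p − C_p·D = 2^{q·K_p}·(C_η·D_p − C_p·D_η)`; in particular when `η` is
empty, `C_ℓ·D_p = C_p·D`. -/
theorem periodic_core_factorization (p t q : ℕ) (hp : 1 ≤ p) (hq : 1 ≤ q)
    (a b : ℕ → ℕ) (ha : ∀ i < p, 1 ≤ a i) (hb : ∀ i < t, 1 ≤ b i) :
    ((wordCarry (q * p + t) (concatPow p q a b) : ℤ) * ((2 : ℤ) ^ wordWt p a - 3 ^ p) -
        (wordCarry p a : ℤ) *
          ((2 : ℤ) ^ (q * wordWt p a + wordWt t b) - 3 ^ (q * p + t)) =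
      2 ^ (q * wordWt p a) *
        ((wordCarry t b : ℤ) * ((2 : ℤ) ^ wordWt p a - 3 ^ p) -
          (wordCarry p a : ℤ) * ((2 : ℤ) ^ wordWt t b - 3 ^ t))) ∧
    (t = 0 →
      (wordCarry (q * p + t) (concatPow p q a b) : ℤ) * ((2 : ℤ) ^ wordWt p a - 3 ^ p) =
        (wordCarry p a : ℤ) *
          ((2 : ℤ) ^ (q * wordWt p a + wordWt t b) - 3 ^ (q * p + t))) := by
  refine ⟨core_identity' p t q a b, ?_⟩
  intro ht
  have h := core_identity' p t q a b
  subst ht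
  have h1 : wordCarry 0 b = 0 := by simp [wordCarry]
  have h2 : wordWt 0 b = 0 := by simp [wordWt]
  have h3 : (2 : ℤ) ^ (q * wordWt p a) *
        ((wordCarry 0 b : ℤ) * ((2 : ℤ) ^ wordWt p a - 3 ^ p) -
          (wordCarry p a : ℤ) * ((2 : ℤ) ^ wordWt 0 b - 3 ^ 0)) = 0 := by
    rw [h1, h2]; simp
  rw [h3] at h
  exact sub_eq_zero.mp h
end

section
/- Let σ = (k_0, …, k_{ℓ−1}) be a tuple of positive integers, let 1 ≤ s ≤ ℓ−1, and let m ≥ 1. Let C(σ) be the carry constant of σ and C(σ^⟨s⟩) the carry constant of the cyclic rotation (k_s, k_{s+1}, …, k_{s+ℓ−1}) (indices mod ℓ). Suppose 2^m divides C(σ^⟨s⟩) − C(σ). Let r be the largest integer with 0 ≤ r ≤ ℓ such that k_0 + k_1 + ⋯ + k_{r−1} < m. Then k_j = k_{(j+s) mod ℓ} for all 0 ≤ j < r: the signature and its rotation agree entry-by-entry until the cumulative prefix valuation reaches m. -/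
theorem wordCarry_succ_aux (L : ℕ) (w : ℕ → ℕ) :
    wordCarry (L + 1) w = 3 ^ L + 2 ^ (w 0) * wordCarry L (fun j => w (j + 1)) := by
  unfold wordCarry
  rw [Finset.sum_range_succ', Finset.mul_sum, add_comm]
  congr 1
  · simp
  · apply Finset.sum_congr rfl
    intro j _
    rw [Finset.sum_range_succ', pow_add]
    have : L + 1 - 1 - (j + 1) = L - 1 - j := by omega
    rw [this]
    ring

theorem wordCarry_odd_aux (L : ℕ) (w : ℕ → ℕ) (hw : 1 ≤ w 0) :
    Odd (wordCarry (L + 1) w) := by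
  rw [wordCarry_succ_aux]
  apply Odd.add_even
  · exact Odd.pow (by decide)
  · apply Even.mul_right
    exact (even_two).pow_of_ne_zero (by omega)

theorem dvd_lt_aux (m p q A B : ℕ) (hA : Odd A) (hp : p < m)
    (h : (2 : ℤ) ^ m ∣ 2 ^ q * (B : ℤ) - 2 ^ p * (A : ℤ)) : q ≤ p := by
  by_contra hq
  have h1 : (2 : ℤ) ^ (p + 1) ∣ 2 ^ q * (B : ℤ) - 2 ^ p * (A : ℤ) :=
    (pow_dvd_pow 2 (by omega)).trans h
  have h2 : (2 : ℤ) ^ (p + 1) ∣ 2 ^ q * (B : ℤ) :=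
    Dvd.dvd.mul_right (pow_dvd_pow 2 (by omega)) _
  have h3 : (2 : ℤ) ^ (p + 1) ∣ 2 ^ p * (A : ℤ) := (dvd_sub_right h2).1 h1
  rw [pow_succ] at h3
  have h4 : (2 : ℤ) ∣ A := (mul_dvd_mul_iff_left (by positivity)).1 h3
  obtain ⟨c, hc⟩ := hA
  omega

theorem overlap_aux (L : ℕ) : ∀ (m r : ℕ) (a b : ℕ → ℕ), (∀ i < L, 1 ≤ a i) →
    (∀ i < L, 1 ≤ b i) → (2 : ℤ) ^ m ∣ (wordCarry L b : ℤ) - (wordCarry L a : ℤ) →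
    r + 1 ≤ L → ∑ i ∈ Finset.range r, a i < m → ∀ j < r, a j = b j := by
  induction L with
  | zero => intro m r a b _ _ _ h; omega
  | succ L ih =>
    intro m r a b ha hb hd hr hsum
    rcases r with _ | r
    · intro j hj; omega
    obtain ⟨M, rfl⟩ : ∃ M, L = M + 1 := ⟨L - 1, by omega⟩
    rw [Finset.sum_range_succ'] at hsum
    have oa := wordCarry_odd_aux M (fun j => a (j + 1)) (ha 1 (by omega))
    have ob := wordCarry_odd_aux M (fun j => b (j + 1)) (hb 1 (by omega))
    rw [wordCarry_succ_aux (M + 1) a, wordCarry_succ_aux (M + 1) b] at hd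
    push_cast at hd
    rw [add_sub_add_left_eq_sub] at hd
    have h1 : b 0 ≤ a 0 := dvd_lt_aux m _ _ _ _ oa (by omega) hd
    have h2 : a 0 ≤ b 0 := dvd_lt_aux m _ _ _ _ ob (by omega) ((dvd_sub_comm).1 hd)
    have h0 : a 0 = b 0 := by omega
    rw [← h0, ← mul_sub] at hd
    have hm : m = a 0 + (m - a 0) := by omega
    rw [hm, pow_add] at hd
    have hd' := (mul_dvd_mul_iff_left (by positivity)).1 hd
    have := ih (m - a 0) r _ _ (fun i hi => ha (i + 1) (by omega))
      (fun i hi => hb (i + 1) (by omega)) hd' (by omega) (by omega)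
    intro j hj
    rcases j with _ | j
    · exact h0
    · exact this j (by omega)

theorem sum_rot_aux (l s : ℕ) (hs : s < l) (k : ℕ → ℕ) :
    ∑ j ∈ Finset.range l, k ((j + s) % l) = ∑ j ∈ Finset.range l, k j := by
  apply Finset.sum_nbij' (fun j => (j + s) % l) (fun j => (j + (l - s)) % l)
  · intro j hj
    exact Finset.mem_range.2 (Nat.mod_lt _ (by omega))
  · intro j hj
    exact Finset.mem_range.2 (Nat.mod_lt _ (by omega))
  · intro j hj
    have hj := Finset.mem_range.1 hj
    rw [Nat.mod_add_mod, show j + s + (l - s) = j + l by omega, Nat.add_mod_right,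
      Nat.mod_eq_of_lt hj]
  · intro j hj
    have hj := Finset.mem_range.1 hj
    rw [Nat.mod_add_mod, show j + (l - s) + s = j + l by omega, Nat.add_mod_right,
      Nat.mod_eq_of_lt hj]
  · intro j _
    rfl

/-- Large intrinsic near-return forces weighted self-overlap: if
`2^m ∣ C(σ^⟨s⟩) − C(σ)` for a signature `σ = (k 0, …, k (ℓ−1))` of positive integers
and `1 ≤ s ≤ ℓ−1`, and `r` is the largest integer `≤ ℓ` whose prefix valuation
`k 0 + ⋯ + k (r−1)` is `< m`, then `k j = k ((j+s) % ℓ)` for all `j < r`. -/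
theorem weighted_self_overlap (ℓ s m : ℕ) (k : ℕ → ℕ) (hk : ∀ i < ℓ, 1 ≤ k i)
    (hs1 : 1 ≤ s) (hs2 : s ≤ ℓ - 1) (hm : 1 ≤ m)
    (hdvd : (2 : ℤ) ^ m ∣
      (wordCarry ℓ (fun j => k ((j + s) % ℓ)) : ℤ) - (wordCarry ℓ k : ℤ))
    (r : ℕ) (hrℓ : r ≤ ℓ) (hrsum : ∑ i ∈ Finset.range r, k i < m)
    (hrmax : ∀ r', r' ≤ ℓ → (∑ i ∈ Finset.range r', k i) < m → r' ≤ r) :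
    ∀ j < r, k j = k ((j + s) % ℓ) := by
  have hb : ∀ i < ℓ, 1 ≤ k ((i + s) % ℓ) := fun i hi => hk _ (Nat.mod_lt _ (by omega))
  rcases Nat.lt_or_ge r ℓ with h | h
  · exact overlap_aux ℓ m r k _ hk hb hdvd (by omega) hrsum
  obtain rfl : r = ℓ := by omega
  obtain ⟨n, rfl⟩ : ∃ n, r = n + 1 := ⟨r - 1, by omega⟩
  have hrot := sum_rot_aux (n + 1) s (by omega) k
  rw [Finset.sum_range_succ] at hrsum
  have key := overlap_aux (n + 1) m n k _ hk hb hdvd (by omega) (by omega)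
  rw [Finset.sum_range_succ, Finset.sum_range_succ] at hrot
  have he : ∑ j ∈ Finset.range n, k j = ∑ j ∈ Finset.range n, k ((j + s) % (n + 1)) :=
    Finset.sum_congr rfl (fun j hj => key j (Finset.mem_range.1 hj))
  intro j hj
  rcases Nat.lt_or_ge j n with h' | h'
  · exact key j h'
  · obtain rfl : j = n := by omega
    omega
end

section
/- Fix integers K ≥ 1 and 1 ≤ ℓ ≤ K. For each strictly increasing tuple 0 = j_0 < j_1 < ⋯ < j_{ℓ−1} ≤ K−1 of natural numbers define C = Σ_{i=0}^{ℓ−1} 3^{ℓ−1−i}·2^{j_i}. Then the assignment (j_0, …, j_{ℓ−1}) ↦ C mod 2^K is injective: if two such tuples (each beginning with j_0 = 0) yield values of C that are congruent modulo 2^K, then the tuples are equal. -/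
theorem coding_aux (K ℓ : ℕ) (j j' : ℕ → ℕ)
    (hjmono : ∀ i₁ i₂, i₁ < i₂ → i₂ < ℓ → j i₁ < j i₂)
    (hj'mono : ∀ i₁ i₂, i₁ < i₂ → i₂ < ℓ → j' i₁ < j' i₂)
    (hjlt : ∀ i < ℓ, j i < K)
    (hcong : (2 ^ K : ℤ) ∣ (∑ i ∈ Finset.range ℓ, (3:ℤ) ^ (ℓ - 1 - i) * 2 ^ j i) -
      (∑ i ∈ Finset.range ℓ, (3:ℤ) ^ (ℓ - 1 - i) * 2 ^ j' i))
    (i : ℕ) (hi : i < ℓ) (hag : ∀ k < i, j k = j' k) : ¬ j i < j' i := by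
  intro hlt
  have h1 := (pow_dvd_pow (2:ℤ) (Nat.succ_le_of_lt (hjlt i hi))).trans hcong
  rw [← Finset.sum_sub_distrib, ← Finset.add_sum_erase _ _ (Finset.mem_range.2 hi)] at h1
  have h2 : (2:ℤ) ^ (j i).succ ∣ ∑ k ∈ (Finset.range ℓ).erase i,
      ((3:ℤ) ^ (ℓ - 1 - k) * 2 ^ j k - 3 ^ (ℓ - 1 - k) * 2 ^ j' k) := by
    apply Finset.dvd_sum
    intro k hk
    simp only [Finset.mem_erase, Finset.mem_range] at hk
    rcases lt_or_gt_of_ne hk.1 with h | h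
    · simp [hag k h]
    · have a := hjmono i k h hk.2
      have b := hj'mono i k h hk.2
      exact dvd_sub (Dvd.dvd.mul_left (pow_dvd_pow _ (by omega)) _)
        (Dvd.dvd.mul_left (pow_dvd_pow _ (by omega)) _)
  have h3 := (dvd_add_left h2).1 h1
  have h4 : (2:ℤ) ^ (j i).succ ∣ 3 ^ (ℓ - 1 - i) * 2 ^ j' i :=
    Dvd.dvd.mul_left (pow_dvd_pow _ (by omega)) _
  have h5 := (dvd_sub_left h4).1 h3
  rw [pow_succ, mul_comm] at h5
  have h6 := Int.dvd_of_mul_dvd_mul_right (by positivity) h5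
  have h7 : Odd ((3:ℤ) ^ (ℓ - 1 - i)) := Odd.pow (by decide)
  exact (Int.not_even_iff_odd.2 h7) (even_iff_two_dvd.2 h6)

/-- Coding-map injectivity: for fixed `K ≥ 1` and `1 ≤ ℓ ≤ K`, the phantom numerator
`C = Σ_{i<ℓ} 3^{ℓ−1−i}·2^{j i}` of a strictly increasing tuple
`0 = j 0 < j 1 < ⋯ < j (ℓ−1) ≤ K−1` determines the tuple modulo `2^K`: if two such
tuples give congruent values of `C (mod 2^K)` then they are equal. -/
theorem coding_map_injectivity (K ℓ : ℕ) (hK : 1 ≤ K) (hℓ1 : 1 ≤ ℓ) (hℓK : ℓ ≤ K)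
    (j j' : ℕ → ℕ)
    (hj0 : j 0 = 0) (hj'0 : j' 0 = 0)
    (hjmono : ∀ i₁ i₂, i₁ < i₂ → i₂ < ℓ → j i₁ < j i₂)
    (hj'mono : ∀ i₁ i₂, i₁ < i₂ → i₂ < ℓ → j' i₁ < j' i₂)
    (hjlt : ∀ i < ℓ, j i ≤ K - 1) (hj'lt : ∀ i < ℓ, j' i ≤ K - 1)
    (hcong : (∑ i ∈ Finset.range ℓ, 3 ^ (ℓ - 1 - i) * 2 ^ j i) % 2 ^ K =
      (∑ i ∈ Finset.range ℓ, 3 ^ (ℓ - 1 - i) * 2 ^ j' i) % 2 ^ K) :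
    ∀ i < ℓ, j i = j' i := by
  have hd : (2 ^ K : ℤ) ∣ (∑ i ∈ Finset.range ℓ, (3:ℤ) ^ (ℓ - 1 - i) * 2 ^ j i) -
      (∑ i ∈ Finset.range ℓ, (3:ℤ) ^ (ℓ - 1 - i) * 2 ^ j' i) := by
    have h := Nat.modEq_iff_dvd.1 (Eq.symm hcong)
    push_cast at h
    exact h
  intro i
  induction i using Nat.strong_induction_on with
  | _ i ih =>
    intro hi
    have hag : ∀ k < i, j k = j' k := fun k hk => ih k hk (hk.trans hi)
    have a := coding_aux K ℓ j j' hjmono hj'mono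
      (fun i h => by have := hjlt i h; omega) hd i hi hag
    have b := coding_aux K ℓ j' j hj'mono hjmono
      (fun i h => by have := hj'lt i h; omega) ((dvd_sub_comm).1 hd) i hi
      (fun k hk => (hag k hk).symm)
    omega
end
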